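/- arXiv:math/9405214 — 2 statements merged into one kernel-verified Lean document; each statement's English description precedes it below -/
import Mathlib

section
/- Let μ be an infinite cardinal, λ = μ⁺, and let ⟨g_α : α < λ⟩ be an enumeration of all functions from ω to μ (every function ω → μ equals g_α for some α < λ). Let δ be a singular cardinal of cofinality ω with δ⁺ ≤ μ. Let P, Q ⊆ λ be such that each of P and Q has order type δ⁺, such that for every α < λ one has range(g_α) ⊆ P ∩ μ if and only if α ∈ P, and likewise range(g_α) ⊆ Q ∩ μ if and only if α ∈ Q, and such that sup P ≠ sup Q. Then P ∩ Q ∩ μ has order type less than δ. -/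
open Cardinal Ordinal Set

/-- The order type of a set of ordinals: the unique ordinal order-isomorphic to it
under its natural ordering.  (It lives one universe up, so we compare it with
`Ordinal.lift`s of ordinals.) -/
noncomputable def otype (A : Set Ordinal.{0}) : Ordinal.{1} :=
  Ordinal.type ((· < ·) : A → A → Prop)

theorem cofinal_aux (P S : Set Ordinal.{0}) (κ : Cardinal.{0}) (hSP : S ⊆ P)
    (hP : otype P = Ordinal.lift.{1} κ.ord) (hS : Cardinal.lift.{1} κ ≤ #S) :
    ∀ x ∈ P, ∃ y ∈ S, x ≤ y := by
  intro x hx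
  by_contra! h
  have h1 := Ordinal.typein_lt_type ((· < ·) : P → P → Prop) ⟨x, hx⟩
  change _ < otype P at h1
  rw [hP, Cardinal.lift_ord, Cardinal.lt_ord] at h1
  have h2 : #S ≤ (Ordinal.typein ((· < ·) : P → P → Prop) ⟨x, hx⟩).card := by
    change #S ≤ #{y : P // y < ⟨x, hx⟩}
    refine Cardinal.mk_le_of_injective
      (f := fun s : S => ⟨⟨s.1, hSP s.2⟩, h s.1 s.2⟩) ?_
    intro a b hab
    simpa [Subtype.ext_iff] using hab
  exact absurd (hS.trans h2) (not_le.2 h1)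

theorem sSup_aux (P S : Set Ordinal.{0}) (hSP : S ⊆ P) (hne : S.Nonempty) (hb : BddAbove P)
    (h : ∀ x ∈ P, ∃ y ∈ S, x ≤ y) : sSup P = sSup S := by
  apply le_antisymm
  · apply csSup_le (hne.mono hSP)
    intro x hx
    obtain ⟨y, hy, hxy⟩ := h x hx
    exact hxy.trans (le_csSup (hb.mono hSP) hy)
  · exact csSup_le_csSup hb hne hSP

/-- **Claim 1 of Magidor–Shelah.**
Let `μ` be an infinite cardinal, `λ = μ⁺`, and `⟨g_α : α < λ⟩` an enumeration of
all functions `ω → μ`.  Let `δ` be a singular cardinal of cofinality `ω` with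
`δ⁺ ≤ μ`.  If `P, Q ⊆ λ` each have order type `δ⁺`, each is closed in the sense
that for all `α < λ`, `range (g_α) ⊆ P ∩ μ ↔ α ∈ P` (and likewise for `Q`), and
`sup P ≠ sup Q`, then `P ∩ Q ∩ μ` has order type less than `δ`. -/
theorem inter_otype_lt_of_sup_ne (μ : Cardinal.{0}) (hμ : ℵ₀ ≤ μ)
    (lam : Cardinal.{0}) (hlam : lam = Order.succ μ)
    (g : Ordinal.{0} → ℕ → Ordinal.{0})
    (hgval : ∀ α < lam.ord, ∀ n : ℕ, g α n < μ.ord)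
    (hgsurj : ∀ h : ℕ → Ordinal.{0}, (∀ n, h n < μ.ord) → ∃ α < lam.ord, g α = h)
    (δ : Cardinal.{0}) (hδunc : ℵ₀ < δ) (hδcof : δ.ord.cof = ℵ₀)
    (hδμ : Order.succ δ ≤ μ)
    (P Q : Set Ordinal.{0}) (hP : P ⊆ Set.Iio lam.ord) (hQ : Q ⊆ Set.Iio lam.ord)
    (hPtype : otype P = Ordinal.lift.{1} (Order.succ δ).ord)
    (hQtype : otype Q = Ordinal.lift.{1} (Order.succ δ).ord)
    (hPrange : ∀ α < lam.ord, (Set.range (g α) ⊆ P ∩ Set.Iio μ.ord ↔ α ∈ P))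
    (hQrange : ∀ α < lam.ord, (Set.range (g α) ⊆ Q ∩ Set.Iio μ.ord ↔ α ∈ Q))
    (hsup : sSup P ≠ sSup Q) :
    otype (P ∩ Q ∩ Set.Iio μ.ord) < Ordinal.lift.{1} δ.ord := by
  by_contra! hA
  apply hsup
  have hcard : Cardinal.lift.{1} δ ≤ #(P ∩ Q ∩ Set.Iio μ.ord : Set Ordinal.{0}) := by
    have := Ordinal.card_le_card hA
    rw [Cardinal.lift_ord, Cardinal.card_ord] at this
    simpa [otype] using this
  have hS : Cardinal.lift.{1} (Order.succ δ) ≤ #(P ∩ Q : Set Ordinal.{0}) := by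
    have h1 : Order.succ δ ≤ δ ^ ℵ₀ := by
      rw [Order.succ_le_iff, ← hδcof]
      exact Cardinal.lt_power_cof_ord hδunc.le
    have h2 : Cardinal.lift.{1} (δ ^ ℵ₀) ≤
        #(ℕ → (P ∩ Q ∩ Set.Iio μ.ord : Set Ordinal.{0})) := by
      rw [Cardinal.lift_power, Cardinal.lift_aleph0]
      simp only [Cardinal.mk_pi, Cardinal.prod_const, Cardinal.mk_nat, Cardinal.lift_aleph0,
        Cardinal.lift_id, Cardinal.lift_uzero]
      exact Cardinal.power_le_power_right hcard
    refine (Cardinal.lift_le.2 h1).trans (h2.trans ?_)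
    choose F hF hgF using fun h : ℕ → (P ∩ Q ∩ Set.Iio μ.ord : Set Ordinal.{0}) =>
      hgsurj (fun n => (h n).1) (fun n => (h n).2.2)
    refine Cardinal.mk_le_of_injective (f := fun h => ⟨F h, ?_, ?_⟩) ?_
    · rw [← hPrange _ (hF h), hgF]
      rintro _ ⟨n, rfl⟩
      exact ⟨(h n).2.1.1, (h n).2.2⟩
    · rw [← hQrange _ (hF h), hgF]
      rintro _ ⟨n, rfl⟩
      exact ⟨(h n).2.1.2, (h n).2.2⟩
    · intro a b hab
      have hab' : F a = F b := congrArg Subtype.val hab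
      have := hgF a
      rw [hab', hgF b] at this
      funext n
      exact Subtype.ext (congrFun this n).symm
  have hne : (P ∩ Q).Nonempty := by
    rw [Set.nonempty_iff_ne_empty]
    intro h0
    rw [h0] at hS
    simp at hS
  have hbP : BddAbove P := ⟨lam.ord, fun x hx => (hP hx).le⟩
  have hbQ : BddAbove Q := ⟨lam.ord, fun x hx => (hQ hx).le⟩
  rw [sSup_aux P (P ∩ Q) inter_subset_left hne hbP
      (cofinal_aux P _ _ inter_subset_left hPtype hS),
    sSup_aux Q (P ∩ Q) inter_subset_right hne hbQ
      (cofinal_aux Q _ _ inter_subset_right hQtype hS)]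
end

section
/- Assume GCH (2^c = c⁺ for every infinite cardinal c). Let μ be an infinite cardinal, λ = μ⁺, and let ⟨g_α : α < λ⟩ be an injective enumeration of all functions from ω to μ. Let δ be a singular cardinal of cofinality ω with δ⁺ ≤ μ, and let P ⊆ λ be such that P ∩ μ has order type δ, P has order type δ⁺, and for every α < λ one has range(g_α) ⊆ P ∩ μ if and only if α ∈ P. Then for every Q ⊆ P that is cofinal in sup P, the set ⋃{range(g_α) : α ∈ Q} has order type exactly δ. -/
open Cardinal Ordinal Set

/-- **Cofinal subsets generate order type `δ`.**
Assume GCH.  Let `μ` be an infinite cardinal, `λ = μ⁺`, and `⟨g_α : α < λ⟩` an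
injective enumeration of all functions `ω → μ`.  Let `δ` be a singular cardinal
of cofinality `ω` with `δ⁺ ≤ μ`, and let `P ⊆ λ` be such that `P ∩ μ` has order
type `δ`, `P` has order type `δ⁺`, and for all `α < λ`,
`range (g_α) ⊆ P ∩ μ ↔ α ∈ P`.  Then for every `Q ⊆ P` cofinal in `sup P`, the
set `⋃ {range (g_α) : α ∈ Q}` has order type exactly `δ`. -/
theorem otype_biUnion_range_eq_of_cofinal
    (hGCH : ∀ c : Cardinal.{0}, ℵ₀ ≤ c → 2 ^ c = Order.succ c)
    (μ : Cardinal.{0}) (hμ : ℵ₀ ≤ μ)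
    (lam : Cardinal.{0}) (hlam : lam = Order.succ μ)
    (g : Ordinal.{0} → ℕ → Ordinal.{0})
    (hgval : ∀ α < lam.ord, ∀ n : ℕ, g α n < μ.ord)
    (hgsurj : ∀ h : ℕ → Ordinal.{0}, (∀ n, h n < μ.ord) → ∃ α < lam.ord, g α = h)
    (hginj : ∀ α < lam.ord, ∀ β < lam.ord, g α = g β → α = β)
    (δ : Cardinal.{0}) (hδunc : ℵ₀ < δ) (hδcof : δ.ord.cof = ℵ₀)
    (hδμ : Order.succ δ ≤ μ)
    (P : Set Ordinal.{0}) (hP : P ⊆ Set.Iio lam.ord)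
    (hPμtype : otype (P ∩ Set.Iio μ.ord) = Ordinal.lift.{1} δ.ord)
    (hPtype : otype P = Ordinal.lift.{1} (Order.succ δ).ord)
    (hPrange : ∀ α < lam.ord, (Set.range (g α) ⊆ P ∩ Set.Iio μ.ord ↔ α ∈ P)) :
    ∀ Q ⊆ P, sSup Q = sSup P →
      otype (⋃ α ∈ Q, Set.range (g α)) = Ordinal.lift.{1} δ.ord := by
  intro Q hQP hsup
  set U : Set Ordinal.{0} := ⋃ α ∈ Q, Set.range (g α) with hU
  have hUP : U ⊆ P ∩ Set.Iio μ.ord := by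
    rw [hU]
    exact Set.iUnion₂_subset fun α hα => (hPrange α (hP (hQP hα))).2 (hQP hα)
  have hle : otype U ≤ Ordinal.lift.{1} δ.ord := by
    rw [← hPμtype]
    exact Ordinal.type_le_iff'.2 ⟨⟨⟨Set.inclusion hUP, Set.inclusion_injective hUP⟩, Iff.rfl⟩⟩
  refine hle.antisymm (not_lt.1 fun hlt => ?_)
  have hδ0 : ℵ₀ ≤ Cardinal.lift.{1} δ := by
    rw [Cardinal.aleph0_le_lift]; exact hδunc.le
  -- card of U
  have hUcard : #U < Cardinal.lift.{1} δ := by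
    rw [Cardinal.lift_ord, Cardinal.lt_ord] at hlt
    simpa [otype] using hlt
  obtain ⟨c, hcU, hc⟩ := Cardinal.lt_lift_iff.1 hUcard
  -- card of P
  have hPcard : #P = Cardinal.lift.{1} (Order.succ δ) := by
    have := congrArg Ordinal.card hPtype
    rw [Cardinal.lift_ord, Cardinal.card_ord] at this
    simpa [otype] using this
  -- card of Q
  have hQcard : #Q ≤ Cardinal.lift.{1} δ := by
    have h1 : #Q ≤ #(ℕ → U) := by
      refine Cardinal.mk_le_of_injective (f := fun q n =>
        (⟨g q.1 n, Set.mem_biUnion q.2 (Set.mem_range_self n)⟩ : U)) ?_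
      intro a b hab
      apply Subtype.ext
      refine hginj _ (hP (hQP a.2)) _ (hP (hQP b.2)) ?_
      funext n
      exact congrArg Subtype.val (congrFun hab n)
    have h2 : c ^ ℵ₀ ≤ δ := by
      calc c ^ ℵ₀ ≤ (2 ^ (max c ℵ₀)) ^ ℵ₀ :=
            Cardinal.power_le_power_right ((le_max_left c ℵ₀).trans (Cardinal.cantor _).le)
        _ = 2 ^ (max c ℵ₀) := by
            rw [← Cardinal.power_mul, Cardinal.mul_aleph0_eq (le_max_right _ _)]
        _ = Order.succ (max c ℵ₀) := hGCH _ (le_max_right _ _)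
        _ ≤ δ := Order.succ_le_of_lt (max_lt hcU hδunc)
    refine h1.trans ?_
    have h3 : #(ℕ → U) = Cardinal.lift.{1} (c ^ ℵ₀) := by
      simp [hc]
    rw [h3]
    exact Cardinal.lift_le.2 h2
  have hbdd : BddAbove P := ⟨lam.ord, fun x hx => (hP hx).le⟩
  have hcov : P ⊆ {sSup P} ∪ Q ∪ ⋃ q : Q, (P ∩ Set.Iio q.1) := by
    intro p hp
    by_cases h : ∃ q ∈ Q, p ≤ q
    · obtain ⟨q, hq, hpq⟩ := h
      rcases hpq.eq_or_lt with rfl | h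
      · exact Or.inl (Or.inr hq)
      · exact Or.inr (Set.mem_iUnion.2 ⟨⟨q, hq⟩, hp, h⟩)
    · push Not at h
      refine Or.inl (Or.inl ?_)
      refine le_antisymm (le_csSup hbdd hp) ?_
      rw [← hsup]
      exact csSup_le' fun q hq => (h q hq).le
  have hseg : ∀ q : Q, #(P ∩ Set.Iio q.1 : Set Ordinal.{0}) ≤ Cardinal.lift.{1} δ := by
    intro q
    have h1 : Ordinal.typein ((· < ·) : P → P → Prop) ⟨q.1, hQP q.2⟩
        < Ordinal.lift.{1} (Order.succ δ).ord := by
      rw [← hPtype]; exact Ordinal.typein_lt_type _ _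
    rw [Cardinal.lift_ord, Cardinal.lt_ord, Cardinal.lift_succ, Order.lt_succ_iff] at h1
    refine le_trans ?_ h1
    refine Cardinal.mk_le_of_injective (f := fun x =>
      (⟨⟨x.1, x.2.1⟩, x.2.2⟩ : {y : P // y < ⟨q.1, hQP q.2⟩})) ?_
    intro a b hab
    apply Subtype.ext
    exact congrArg (fun z => z.1.1) hab
  have hfin : #P ≤ Cardinal.lift.{1} δ := by
    refine (Cardinal.mk_le_mk_of_subset hcov).trans ?_
    refine (Cardinal.mk_union_le _ _).trans (Cardinal.add_le_of_le hδ0 ?_ ?_)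
    · refine (Cardinal.mk_union_le _ _).trans (Cardinal.add_le_of_le hδ0 ?_ hQcard)
      rw [Cardinal.mk_singleton]
      exact Cardinal.one_le_aleph0.trans hδ0
    · refine (Cardinal.mk_iUnion_le _).trans ?_
      exact Cardinal.mul_le_of_le hδ0 hQcard (ciSup_le' hseg)
  rw [hPcard, Cardinal.lift_le] at hfin
  exact absurd hfin (not_le.2 (Order.lt_succ δ))
end
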